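/- Let F(τ) = η(29τ)²/η(τ)² for τ with Im τ > 0. For every a, b, c, d ∈ ℤ with ad − bc = 1 and c ≡ 0 (mod 29), there exists w ∈ ℂ with w¹² = 1 such that F((aτ+b)/(cτ+d)) = w·F(τ) for all τ ∈ ℂ with Im τ > 0. -/

import Mathlib

/-- The Dedekind eta function `η(τ) = e^{πiτ/12} ∏_{n≥1} (1 - e^{2πinτ})`. -/
noncomputable def dedekindEta (τ : ℂ) : ℂ :=
  Complex.exp (Real.pi * Complex.I * τ / 12) *
    ∏' n : ℕ, (1 - Complex.exp (2 * Real.pi * Complex.I * (n + 1) * τ))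

/-- `F(τ) = η(29τ)² / η(τ)²`. -/
noncomputable def F29 (τ : ℂ) : ℂ :=
  dedekindEta (29 * τ) ^ 2 / dedekindEta τ ^ 2

theorem dedekindEta_eq_eta (τ : ℂ) : dedekindEta τ = ModularForm.eta τ := by
  simp only [dedekindEta, ModularForm.eta, ModularForm.eta_q_eq_cexp, Function.Periodic.qParam]
  congr 2
  push_cast
  ring

theorem dedekindEta_ne_zero {τ : ℂ} (hτ : 0 < τ.im) : dedekindEta τ ≠ 0 := by
  rw [dedekindEta_eq_eta]
  exact ModularForm.eta_ne_zero hτ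

theorem continuousAt_dedekindEta {τ : ℂ} (hτ : 0 < τ.im) : ContinuousAt dedekindEta τ := by
  rw [funext dedekindEta_eq_eta]
  exact (ModularForm.differentiableAt_eta_of_mem_upperHalfPlaneSet hτ).continuousAt

/-- The Möbius transformation of an integer matrix of determinant one: its denominator does not
vanish on the upper half-plane, which it preserves, and `η ^ 24` is modular of weight `12`. -/
theorem dedekindEta_pow_moebius (a b c d : ℤ) (h : a * d - b * c = 1) {τ : ℂ} (hτ : 0 < τ.im) :
    (c : ℂ) * τ + d ≠ 0 ∧ 0 < (((a : ℂ) * τ + b) / (c * τ + d)).im ∧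
      dedekindEta ((a * τ + b) / (c * τ + d)) ^ 24 = (c * τ + d) ^ 12 * dedekindEta τ ^ 24 := by
  let γ : Matrix.SpecialLinearGroup (Fin 2) ℤ :=
    ⟨!![a, b; c, d], by rw [Matrix.det_fin_two_of, h]⟩
  let z : UpperHalfPlane := ⟨τ, hτ⟩
  have hsmul : ((γ • z : UpperHalfPlane) : ℂ) = (a * τ + b) / (c * τ + d) := by
    rw [UpperHalfPlane.coe_specialLinearGroup_apply]
    simp [γ, z]
  have hdenom : UpperHalfPlane.denom γ z = c * τ + d := by
    rw [ModularGroup.denom_apply]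
    simp [γ, z]
  have hne : (c : ℂ) * τ + d ≠ 0 := hdenom ▸ UpperHalfPlane.denom_ne_zero γ z
  refine ⟨hne, hsmul ▸ (γ • z).im_pos, ?_⟩
  have hslash := congrFun (SlashInvariantForm.slash_action_generators_SL2Z
    ModularForm.discriminant_S_invariant ModularForm.discriminant_T_invariant γ) z
  rw [ModularForm.SL_slash_apply, hdenom, ModularForm.discriminant, ModularForm.discriminant,
    hsmul, ← dedekindEta_eq_eta, ← dedekindEta_eq_eta, zpow_neg,
    mul_inv_eq_iff_eq_mul₀ (zpow_ne_zero _ hne)] at hslash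
  rw [hslash, mul_comm]
  rfl

theorem im_twentyNine_mul_pos {τ : ℂ} (hτ : 0 < τ.im) : 0 < (29 * τ : ℂ).im := by
  simpa using hτ

theorem F29_ne_zero {τ : ℂ} (hτ : 0 < τ.im) : F29 τ ≠ 0 :=
  div_ne_zero (pow_ne_zero _ (dedekindEta_ne_zero (im_twentyNine_mul_pos hτ)))
    (pow_ne_zero _ (dedekindEta_ne_zero hτ))

theorem continuousAt_F29 {τ : ℂ} (hτ : 0 < τ.im) : ContinuousAt F29 τ :=
  (((continuousAt_dedekindEta (im_twentyNine_mul_pos hτ)).comp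
    (continuousAt_const.mul continuousAt_id)).pow 2).div
    ((continuousAt_dedekindEta hτ).pow 2) (pow_ne_zero _ (dedekindEta_ne_zero hτ))

/-- `F ^ 12` is invariant under `Γ₀(29)`. -/
theorem F29_pow_moebius (a b c d : ℤ) (h : a * d - b * c = 1) (hc : (29 : ℤ) ∣ c) {τ : ℂ}
    (hτ : 0 < τ.im) : F29 ((a * τ + b) / (c * τ + d)) ^ 12 = F29 τ ^ 12 := by
  obtain ⟨e, rfl⟩ := hc
  obtain ⟨hne, -, hη⟩ := dedekindEta_pow_moebius a b (29 * e) d h hτ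
  obtain ⟨-, -, hη'⟩ := dedekindEta_pow_moebius a (29 * b) e d (by linarith)
    (im_twentyNine_mul_pos hτ)
  have harg : (29 : ℂ) * ((a * τ + b) / ((29 * e : ℤ) * τ + d)) =
      (a * (29 * τ) + (29 * b : ℤ)) / (e * (29 * τ) + d) := by
    push_cast
    rw [← mul_div_assoc]
    congr 1 <;> ring
  have hden : (e : ℂ) * (29 * τ) + d = (29 * e : ℤ) * τ + d := by
    push_cast
    ring
  simp only [F29, div_pow, ← pow_mul, Nat.reduceMul]
  rw [harg, hη', hη, hden, mul_div_mul_left _ _ (pow_ne_zero _ hne)]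

/-- The span of `F(τ) = η(29τ)²/η(τ)²` is preserved, up to a twelfth root of unity,
by every element of `Γ₀(29)`. -/
theorem gamma0_29_invariance_29AB (a b c d : ℤ) (h : a * d - b * c = 1) (hc : (29 : ℤ) ∣ c) :
    ∃ w : ℂ, w ^ 12 = 1 ∧ ∀ τ : ℂ, 0 < τ.im →
      F29 (((a : ℂ) * τ + (b : ℂ)) / ((c : ℂ) * τ + (d : ℂ))) = w * F29 τ := by
  have hpre : IsPreconnected {τ : ℂ | 0 < τ.im} := (convex_halfSpace_im_gt 0).isPreconnected
  have hfin : {w : ℂ | w ^ 12 = 1}.Finite := by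
    refine (Polynomial.nthRoots 12 (1 : ℂ)).toFinset.finite_toSet.subset fun w hw => ?_
    simpa [Polynomial.mem_nthRoots] using hw
  obtain ⟨w, hw, hconst⟩ := hpre.eqOn_const_of_mapsTo hfin.isDiscrete
    (f := fun τ => F29 ((a * τ + b) / (c * τ + d)) / F29 τ)
    (fun τ hτ => by
      obtain ⟨hne, him, -⟩ := dedekindEta_pow_moebius a b c d h hτ
      have hmoebius : ContinuousAt (fun z : ℂ => (a * z + b) / (c * z + d)) τ :=
        ContinuousAt.div (by fun_prop) (by fun_prop) hne
      exact (((continuousAt_F29 him).comp_of_eq hmoebius rfl).div (continuousAt_F29 hτ)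
        (F29_ne_zero hτ)).continuousWithinAt)
    (fun τ hτ => by
      rw [Set.mem_ofPred_eq, div_pow, F29_pow_moebius a b c d h hc hτ,
        div_self (pow_ne_zero _ (F29_ne_zero hτ))])
    ⟨1, one_pow 12⟩
  exact ⟨w, hw, fun τ hτ => (div_eq_iff (F29_ne_zero hτ)).mp (hconst hτ)⟩
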